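/- Let p be an odd prime and let a ∈ ℚ_p with |a|_p > 1. Define f : ℤ_p → ℚ_p by f(t) := ζ_{p,E}(t,a) − ⟨a⟩^{1−t}, and for n ∈ ℕ and s ∈ ℤ_p let exp_p(nD)f(s) := f(s) + Σ_{k=1}^∞ (n^k/k!)·D^k f(s), where D^k f denotes the k-th iterated derivative of f within ℤ_p. Define P_0(s) := 2/(s−1), P_1(s) := 1/ω_v(a), and P_n(s) := (∏_{j=1}^{n−1}(s−1+j)) / (n!·ω_v(a)^n) for n ≥ 2. Then for every s ∈ ℤ_p with s ≠ 1, all series involved converge in ℚ_p and Σ_{n=0}^∞ P_n(s)·exp_p(nD)f(s) = (1/(s−1))·(⟨a−1⟩^{1−s} − ⟨a⟩^{1−s}). -/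

import Mathlib

open Filter Topology

noncomputable def teich (p : ℕ) [Fact p.Prime] (u : ℚ_[p]) : ℚ_[p] :=
  limUnder atTop fun n : ℕ => u ^ p ^ n

noncomputable def omegaV (p : ℕ) [Fact p.Prime] (a : ℚ_[p]) : ℚ_[p] :=
  (p : ℚ_[p]) ^ a.valuation * teich p (a * (p : ℚ_[p]) ^ (-a.valuation))

noncomputable def proj (p : ℕ) [Fact p.Prime] (a : ℚ_[p]) : ℚ_[p] :=
  a / omegaV p a

noncomputable def binom (p : ℕ) [Fact p.Prime] (s : ℚ_[p]) (n : ℕ) : ℚ_[p] :=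
  (∏ j ∈ Finset.range n, (s - (j : ℚ_[p]))) / (n.factorial : ℚ_[p])

noncomputable def hpow (p : ℕ) [Fact p.Prime] (a s : ℚ_[p]) : ℚ_[p] :=
  ∑' n : ℕ, binom p s n * (proj p a - 1) ^ n

noncomputable def zetaE (p : ℕ) [Fact p.Prime] (s a : ℚ_[p]) : ℚ_[p] :=
  limUnder atTop fun r : ℕ =>
    ∑ k ∈ Finset.range (p ^ r), (-1 : ℚ_[p]) ^ k * hpow p ((k : ℚ_[p]) + a) (1 - s)

noncomputable def coeffT (p : ℕ) [Fact p.Prime] (s a : ℚ_[p]) (n : ℕ) : ℚ_[p] :=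
  (∏ j ∈ Finset.Icc 1 (n - 1), (s - 1 + (j : ℚ_[p]))) /
    ((n.factorial : ℚ_[p]) * omegaV p a ^ n)

/-- The closed unit ball `ℤ_p` regarded as a subset of `ℚ_p`. -/
def Zball (p : ℕ) [Fact p.Prime] : Set ℚ_[p] := {x : ℚ_[p] | ‖x‖ ≤ 1}

/-- The coefficients `P_{p,n}^a(s)` of the p-adic Van Gorder operator `T_p^a`. -/
noncomputable def Pcoef (p : ℕ) [Fact p.Prime] (s a : ℚ_[p]) : ℕ → ℚ_[p]
  | 0 => 2 / (s - 1)
  | 1 => 1 / omegaV p a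
  | n + 2 => coeffT p s a (n + 2)

section

variable {p : ℕ} [Fact p.Prime]

lemma one_lt_prime_cast : (1 : ℝ) < p := by exact_mod_cast (Fact.out : p.Prime).one_lt

lemma inv_prime_cast_pos : (0 : ℝ) < (p : ℝ)⁻¹ := inv_pos.2 (zero_lt_one.trans one_lt_prime_cast)

lemma inv_prime_cast_lt_one : (p : ℝ)⁻¹ < 1 := inv_lt_one_of_one_lt₀ one_lt_prime_cast

lemma norm_le_inv_iff_lt_one (x : ℚ_[p]) : ‖x‖ ≤ (p : ℝ)⁻¹ ↔ ‖x‖ < 1 := by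
  have := Padic.norm_le_pow_iff_norm_lt_pow_add_one x (-1)
  simpa using this

/-! ### The Teichmüller representative -/

lemma PadicInt.p_dvd_pow_sub_self (u : ℤ_[p]) : (p : ℤ_[p]) ∣ u ^ p - u := by
  rw [← Ideal.mem_span_singleton, ← PadicInt.maximalIdeal_eq_span_p, ← PadicInt.ker_toZMod,
    RingHom.mem_ker]
  simp [ZMod.pow_card]

lemma PadicInt.norm_pow_sub_pow_le {u v : ℤ_[p]} (h : (p : ℤ_[p]) ∣ u - v) (n : ℕ) :
    ‖u ^ p ^ n - v ^ p ^ n‖ ≤ (p : ℝ)⁻¹ * (p : ℝ)⁻¹ ^ n := by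
  obtain ⟨c, hc⟩ := dvd_sub_pow_of_dvd_sub h n
  rw [hc, norm_mul, norm_pow, PadicInt.norm_p, pow_succ, mul_comm (_ ^ n)]
  exact mul_le_of_le_one_right (by positivity) (PadicInt.norm_le_one c)

lemma exists_tendsto_pow_prime_pow {u : ℚ_[p]} (hu : ‖u‖ ≤ 1) :
    ∃ L : ℚ_[p], Tendsto (fun n : ℕ => u ^ p ^ n) atTop (𝓝 L) ∧ ‖L - u‖ ≤ (p : ℝ)⁻¹ := by
  obtain ⟨u, rfl⟩ : ∃ z : ℤ_[p], (z : ℚ_[p]) = u := ⟨⟨u, hu⟩, rfl⟩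
  have hstep : ∀ n : ℕ, ‖(u : ℚ_[p]) ^ p ^ n - (u : ℚ_[p]) ^ p ^ (n + 1)‖ ≤
      (p : ℝ)⁻¹ * (p : ℝ)⁻¹ ^ n := fun n => by
    have := PadicInt.norm_pow_sub_pow_le (PadicInt.p_dvd_pow_sub_self u) n
    rw [← pow_mul, ← pow_succ', norm_sub_rev] at this
    exact_mod_cast this
  have hcauchy : CauchySeq fun n : ℕ => (u : ℚ_[p]) ^ p ^ n :=
    cauchySeq_of_le_geometric _ _ inv_prime_cast_lt_one fun n => by
      rw [dist_eq_norm]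
      exact hstep n
  obtain ⟨L, hL⟩ := cauchySeq_tendsto_of_complete hcauchy
  have htend : Tendsto (fun n : ℕ => ‖(u : ℚ_[p]) ^ p ^ n - u‖) atTop (𝓝 ‖L - u‖) :=
    (hL.sub_const _).norm
  refine ⟨L, hL, le_of_tendsto htend (.of_forall fun n => ?_)⟩
  induction n with
  | zero => simp
  | succ n ih =>
    rw [← sub_add_sub_cancel _ ((u : ℚ_[p]) ^ p ^ n)]
    refine (IsUltrametricDist.norm_add_le_max _ _).trans (max_le ?_ ih)
    rw [norm_sub_rev]
    exact (hstep n).trans (mul_le_of_le_one_right inv_prime_cast_pos.le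
      (pow_le_one₀ inv_prime_cast_pos.le inv_prime_cast_lt_one.le))

lemma norm_teich_sub_le {u : ℚ_[p]} (hu : ‖u‖ ≤ 1) : ‖teich p u - u‖ ≤ (p : ℝ)⁻¹ := by
  obtain ⟨L, hL, h⟩ := exists_tendsto_pow_prime_pow hu
  rwa [teich, hL.limUnder_eq]

lemma teich_congr {u v : ℚ_[p]} (hu : ‖u‖ ≤ 1) (hv : ‖v‖ ≤ 1) (h : ‖u - v‖ < 1) :
    teich p u = teich p v := by
  obtain ⟨L, hL, -⟩ := exists_tendsto_pow_prime_pow hu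
  obtain ⟨M, hM, -⟩ := exists_tendsto_pow_prime_pow hv
  rw [teich, teich, hL.limUnder_eq, hM.limUnder_eq, ← sub_eq_zero]
  refine tendsto_nhds_unique (hL.sub hM) ?_
  obtain ⟨u, rfl⟩ : ∃ z : ℤ_[p], (z : ℚ_[p]) = u := ⟨⟨u, hu⟩, rfl⟩
  obtain ⟨v, rfl⟩ : ∃ z : ℤ_[p], (z : ℚ_[p]) = v := ⟨⟨v, hv⟩, rfl⟩
  refine squeeze_zero_norm (a := fun n => (p : ℝ)⁻¹ * (p : ℝ)⁻¹ ^ n) (fun n => ?_) ?_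
  · have := PadicInt.norm_pow_sub_pow_le ((PadicInt.norm_lt_one_iff_dvd (u - v)).1
      (by exact_mod_cast h)) n
    exact_mod_cast this
  · simpa using (tendsto_pow_atTop_nhds_zero_of_lt_one inv_prime_cast_pos.le
      (inv_prime_cast_lt_one (p := p))).const_mul (p : ℝ)⁻¹

lemma norm_mul_zpow_neg_valuation {a : ℚ_[p]} (ha : a ≠ 0) :
    ‖a * (p : ℚ_[p]) ^ (-a.valuation)‖ = 1 := by
  have hp : (p : ℝ) ≠ 0 := (zero_lt_one.trans one_lt_prime_cast).ne'
  rw [norm_mul, Padic.norm_eq_zpow_neg_valuation ha, Padic.norm_p_zpow, neg_neg,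
    ← zpow_add₀ hp, neg_add_cancel, zpow_zero]

lemma norm_teich {u : ℚ_[p]} (hu : ‖u‖ = 1) : ‖teich p u‖ = 1 := by
  have h := (norm_teich_sub_le hu.le).trans_lt inv_prime_cast_lt_one
  rw [← hu] at h ⊢
  exact Padic.norm_eq_of_norm_sub_lt_right h

lemma norm_omegaV {a : ℚ_[p]} (ha : a ≠ 0) : ‖omegaV p a‖ = ‖a‖ := by
  rw [omegaV, norm_mul, norm_teich (norm_mul_zpow_neg_valuation ha), mul_one,
    Padic.norm_p_zpow, Padic.norm_eq_zpow_neg_valuation ha]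

lemma norm_proj_sub_one_le {a : ℚ_[p]} (ha : a ≠ 0) : ‖proj p a - 1‖ ≤ (p : ℝ)⁻¹ := by
  have hp : (p : ℚ_[p]) ≠ 0 := by exact_mod_cast (Fact.out : p.Prime).ne_zero
  have hu := norm_mul_zpow_neg_valuation ha
  have hL := norm_teich hu
  set u := a * (p : ℚ_[p]) ^ (-a.valuation) with hu_def
  have hL0 : teich p u ≠ 0 := norm_pos_iff.1 (by rw [hL]; exact one_pos)
  have h : proj p a - 1 = (u - teich p u) / teich p u := by
    have ha' : a = (p : ℚ_[p]) ^ a.valuation * u := by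
      rw [hu_def, mul_left_comm, ← zpow_add₀ hp, add_neg_cancel, zpow_zero, mul_one]
    rw [sub_div, div_self hL0, proj, omegaV, ← hu_def]
    nth_rw 1 [ha']
    rw [mul_div_mul_left _ _ (zpow_ne_zero _ hp)]
  rw [h, norm_div, hL, div_one, norm_sub_rev]
  exact norm_teich_sub_le hu.le

lemma omegaV_add {a b : ℚ_[p]} (ha : 1 < ‖a‖) (hb : ‖b‖ ≤ 1) :
    omegaV p (b + a) = omegaV p a := by
  have hp1 : (1 : ℝ) < p := one_lt_prime_cast
  have ha0 : a ≠ 0 := norm_pos_iff.1 (one_pos.trans ha)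
  have hn : ‖b + a‖ = ‖a‖ :=
    Padic.norm_eq_of_norm_sub_lt_right (by simpa using hb.trans_lt ha)
  have hba0 : b + a ≠ 0 := norm_pos_iff.1 (by rw [hn]; exact one_pos.trans ha)
  have hv : (b + a).valuation = a.valuation := by
    rw [Padic.norm_eq_zpow_neg_valuation ha0, Padic.norm_eq_zpow_neg_valuation hba0] at hn
    exact neg_injective (zpow_right_injective₀ (by positivity) hp1.ne' hn)
  have hu := norm_mul_zpow_neg_valuation ha0
  rw [omegaV, omegaV, hv]
  congr 1
  refine teich_congr (hv ▸ (norm_mul_zpow_neg_valuation hba0).le) hu.le ?_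
  rw [← sub_mul, add_sub_cancel_right, norm_mul]
  rw [norm_mul] at hu
  have hpos : 0 < ‖(p : ℚ_[p]) ^ (-a.valuation)‖ := by
    by_contra! h
    nlinarith [norm_nonneg ((p : ℚ_[p]) ^ (-a.valuation))]
  nlinarith

/-! ### The binomial series -/

lemma norm_binom_le_one {s : ℚ_[p]} (hs : ‖s‖ ≤ 1) (n : ℕ) : ‖binom p s n‖ ≤ 1 := by
  obtain ⟨s, rfl⟩ : ∃ z : ℤ_[p], (z : ℚ_[p]) = s := ⟨⟨s, hs⟩, rfl⟩
  have h : ∏ j ∈ Finset.range n, ((s : ℚ_[p]) - j) =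
      (-1) ^ n * ((ascPochhammer ℤ_[p] n).eval (-s) : ℤ_[p]) := by
    induction n with
    | zero => simp
    | succ n ih =>
      rw [Finset.prod_range_succ, ih, ascPochhammer_succ_eval]
      push_cast
      ring
  have h2 := PadicInt.norm_ascPochhammer_le n (-s)
  rw [binom, h, norm_div, norm_mul, norm_pow, norm_neg, norm_one, one_pow, one_mul]
  refine div_le_one_of_le₀ ?_ (norm_nonneg _)
  rwa [PadicInt.norm_def, PadicInt.norm_def, PadicInt.coe_natCast] at h2

lemma binom_mul_binom (s : ℚ_[p]) (n m : ℕ) :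
    binom p s n * binom p (s - n) m = binom p s (n + m) * ((n + m).choose n : ℚ_[p]) := by
  have h1 : ((n + m).choose n : ℚ_[p]) * n.factorial * m.factorial = (n + m).factorial := by
    rw [mul_right_comm, Nat.choose_symm_add]
    exact_mod_cast (mul_right_comm _ _ _).trans (Nat.add_choose_mul_factorial_mul_factorial n m)
  have hn : (n.factorial : ℚ_[p]) ≠ 0 := by exact_mod_cast n.factorial_ne_zero
  have hm : (m.factorial : ℚ_[p]) ≠ 0 := by exact_mod_cast m.factorial_ne_zero
  have hnm : ((n + m).factorial : ℚ_[p]) ≠ 0 := by exact_mod_cast (n + m).factorial_ne_zero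
  have h2 : ∏ j ∈ Finset.range m, (s - n - (j : ℚ_[p])) =
      ∏ j ∈ Finset.range m, (s - ((n + j : ℕ) : ℚ_[p])) :=
    Finset.prod_congr rfl fun j _ => by push_cast; ring
  simp only [binom]
  rw [Finset.prod_range_add, h2, div_mul_div_comm, div_mul_eq_mul_div,
    div_eq_div_iff (mul_ne_zero hn hm) hnm, ← h1]
  ring

noncomputable def binomSeries (p : ℕ) [Fact p.Prime] (s x : ℚ_[p]) : ℚ_[p] :=
  ∑' n : ℕ, binom p s n * x ^ n

lemma hpow_eq_binomSeries (a s : ℚ_[p]) : hpow p a s = binomSeries p s (proj p a - 1) := rfl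

lemma norm_binom_mul_pow_le {s x : ℚ_[p]} (hs : ‖s‖ ≤ 1) (hx : ‖x‖ ≤ (p : ℝ)⁻¹) (n : ℕ) :
    ‖binom p s n * x ^ n‖ ≤ (p : ℝ)⁻¹ ^ n := by
  rw [norm_mul, norm_pow]
  exact (mul_le_of_le_one_left (by positivity) (norm_binom_le_one hs n)).trans
    (pow_le_pow_left₀ (norm_nonneg _) hx n)

lemma summable_inv_prime_pow : Summable fun n : ℕ => (p : ℝ)⁻¹ ^ n :=
  summable_geometric_of_lt_one inv_prime_cast_pos.le inv_prime_cast_lt_one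

lemma summable_binom_mul_pow {s x : ℚ_[p]} (hs : ‖s‖ ≤ 1) (hx : ‖x‖ ≤ (p : ℝ)⁻¹) :
    Summable fun n : ℕ => binom p s n * x ^ n :=
  .of_norm_bounded summable_inv_prime_pow (norm_binom_mul_pow_le hs hx)

lemma norm_binomSeries_le_one {s x : ℚ_[p]} (hs : ‖s‖ ≤ 1) (hx : ‖x‖ ≤ (p : ℝ)⁻¹) :
    ‖binomSeries p s x‖ ≤ 1 :=
  IsUltrametricDist.norm_tsum_le_of_forall_le fun n => (norm_binom_mul_pow_le hs hx n).trans
    (pow_le_one₀ inv_prime_cast_pos.le inv_prime_cast_lt_one.le)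

lemma norm_pow_sub_pow_le_norm_sub {x y : ℚ_[p]} (hx : ‖x‖ ≤ 1) (hy : ‖y‖ ≤ 1) (n : ℕ) :
    ‖x ^ n - y ^ n‖ ≤ ‖x - y‖ := by
  induction n with
  | zero => simp
  | succ n ih =>
    have h : x ^ (n + 1) - y ^ (n + 1) = x * (x ^ n - y ^ n) + (x - y) * y ^ n := by ring
    rw [h]
    refine (IsUltrametricDist.norm_add_le_max _ _).trans (max_le ?_ ?_)
    · rw [norm_mul]
      exact (mul_le_of_le_one_left (norm_nonneg _) hx).trans ih
    · rw [norm_mul, norm_pow]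
      exact mul_le_of_le_one_right (norm_nonneg _) (pow_le_one₀ (norm_nonneg _) hy)

lemma norm_binomSeries_sub_le {s x y : ℚ_[p]} (hs : ‖s‖ ≤ 1) (hx : ‖x‖ ≤ (p : ℝ)⁻¹)
    (hy : ‖y‖ ≤ (p : ℝ)⁻¹) : ‖binomSeries p s x - binomSeries p s y‖ ≤ ‖x - y‖ := by
  rw [binomSeries, binomSeries,
    ← (summable_binom_mul_pow hs hx).tsum_sub (summable_binom_mul_pow hs hy)]
  refine IsUltrametricDist.norm_tsum_le_of_forall_le fun n => ?_
  rw [← mul_sub, norm_mul]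
  exact (mul_le_of_le_one_left (norm_nonneg _) (norm_binom_le_one hs n)).trans
    (norm_pow_sub_pow_le_norm_sub (hx.trans inv_prime_cast_lt_one.le)
      (hy.trans inv_prime_cast_lt_one.le) n)

lemma norm_sub_natCast_le_one {s : ℚ_[p]} (hs : ‖s‖ ≤ 1) (n : ℕ) : ‖s - n‖ ≤ 1 :=
  by
  rw [sub_eq_add_neg]
  exact (IsUltrametricDist.norm_add_le_max _ _).trans
    (max_le hs (by simpa using IsUltrametricDist.norm_natCast_le_one ℚ_[p] n))

/-- Taylor expansion of `x ↦ (1 + x) ^ s`. -/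
lemma tsum_binom_mul_pow_mul_binomSeries {s x y : ℚ_[p]} (hs : ‖s‖ ≤ 1) (hx : ‖x‖ ≤ (p : ℝ)⁻¹)
    (hy : ‖y‖ ≤ (p : ℝ)⁻¹) :
    ∑' n : ℕ, binom p s n * y ^ n * binomSeries p (s - n) x = binomSeries p s (x + y) := by
  have hsum : Summable fun z : ℕ × ℕ =>
      binom p s z.1 * y ^ z.1 * (binom p (s - z.1) z.2 * x ^ z.2) := by
    refine .of_norm_bounded (g := fun z : ℕ × ℕ => (p : ℝ)⁻¹ ^ z.1 * (p : ℝ)⁻¹ ^ z.2)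
      ((summable_inv_prime_pow (p := p)).mul_of_nonneg
      (summable_inv_prime_pow (p := p))
      (fun n => ?_) fun n => ?_) fun z => ?_
    · dsimp; positivity
    · dsimp; positivity
    · rw [norm_mul]
      exact mul_le_mul (norm_binom_mul_pow_le hs hy _)
        (norm_binom_mul_pow_le (norm_sub_natCast_le_one hs _) hx _) (norm_nonneg _) (by positivity)
  have hL : ∑' n : ℕ, binom p s n * y ^ n * binomSeries p (s - n) x =
      ∑' z : ℕ × ℕ, binom p s z.1 * y ^ z.1 * (binom p (s - z.1) z.2 * x ^ z.2) := by
    rw [hsum.tsum_prod]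
    simp only [binomSeries, tsum_mul_left]
  rw [hL, ← Finset.HasAntidiagonal.sigmaAntidiagonalEquivProd.tsum_eq]
  refine (Summable.tsum_sigma' (fun n => (hasSum_fintype _).summable)
    (Finset.HasAntidiagonal.sigmaAntidiagonalEquivProd.summable_iff.2 hsum)).trans ?_
  rw [binomSeries]
  refine tsum_congr fun N => ?_
  rw [tsum_fintype, add_comm x y, (Commute.all y x).add_pow']
  rw [Finset.mul_sum]
  rw [← Finset.sum_coe_sort (Finset.HasAntidiagonal.antidiagonal N)]
  refine Finset.sum_congr rfl fun z _ => ?_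
  obtain ⟨⟨n, m⟩, hz⟩ := z
  obtain rfl : n + m = N := Finset.HasAntidiagonal.mem_antidiagonal.1 hz
  have := binom_mul_binom s n m
  simp only [Function.comp_apply, Finset.HasAntidiagonal.sigmaAntidiagonalEquivProd_apply,
    nsmul_eq_mul]
  linear_combination y ^ n * x ^ m * this

/-! ### Alternating sums -/

/-- The partial sums defining the fermionic `p`-adic integral of `g`. -/
noncomputable def altSum (p : ℕ) [Fact p.Prime] (g : ℕ → ℚ_[p]) (r : ℕ) : ℚ_[p] :=
  ∑ k ∈ Finset.range (p ^ r), (-1 : ℚ_[p]) ^ k * g k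

lemma norm_neg_one_pow_mul (k : ℕ) (x : ℚ_[p]) : ‖(-1 : ℚ_[p]) ^ k * x‖ = ‖x‖ := by
  rw [norm_mul, norm_pow, norm_neg, norm_one, one_pow, one_mul]

lemma norm_altSum_le {g : ℕ → ℚ_[p]} {C : ℝ} (hC : 0 ≤ C) (hg : ∀ k, ‖g k‖ ≤ C) (r : ℕ) :
    ‖altSum p g r‖ ≤ C :=
  IsUltrametricDist.norm_sum_le_of_forall_le_of_nonneg hC fun k _ => by
    rw [norm_neg_one_pow_mul]
    exact hg k

lemma odd_prime_pow (hodd : p ≠ 2) (r : ℕ) : Odd (p ^ r) :=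
  ((Fact.out : p.Prime).odd_of_ne_two hodd).pow

lemma norm_sum_range_odd_mul_sub_le {g : ℕ → ℚ_[p]}
    (hg : ∀ k l : ℕ, ‖g (l + k) - g k‖ ≤ ‖(l : ℚ_[p])‖) {N : ℕ} (hN : Odd N) (j : ℕ) :
    ‖∑ k ∈ Finset.range ((2 * j + 1) * N), (-1 : ℚ_[p]) ^ k * g k -
      ∑ k ∈ Finset.range N, (-1 : ℚ_[p]) ^ k * g k‖ ≤ ‖(N : ℚ_[p])‖ := by
  induction j with
  | zero => simp
  | succ j ih =>
    have hM : (2 * (j + 1) + 1) * N = (2 * j + 1) * N + N + N := by ring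
    rw [hM, Finset.sum_range_add, Finset.sum_range_add, add_assoc, add_sub_right_comm,
      ← Finset.sum_add_distrib]
    refine (IsUltrametricDist.norm_add_le_max _ _).trans (max_le ih ?_)
    refine IsUltrametricDist.norm_sum_le_of_forall_le_of_nonneg (norm_nonneg _) fun i _ => ?_
    set c := (2 * j + 1) * N
    have h : (-1 : ℚ_[p]) ^ (c + i) * g (c + i) + (-1) ^ (c + N + i) * g (c + N + i) =
        (-1) ^ (c + N + i) * (g (N + (c + i)) - g (c + i)) := by
      rw [show N + (c + i) = c + N + i by ring, pow_add _ (c + N) i, pow_add _ c N,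
        hN.neg_one_pow, pow_add]
      ring
    rw [h, norm_neg_one_pow_mul]
    exact hg _ _

lemma exists_tendsto_altSum (hodd : p ≠ 2) {g : ℕ → ℚ_[p]}
    (hg : ∀ k l : ℕ, ‖g (l + k) - g k‖ ≤ ‖(l : ℚ_[p])‖) :
    ∃ L, Tendsto (altSum p g) atTop (𝓝 L) := by
  refine cauchySeq_tendsto_of_complete
    (cauchySeq_of_le_geometric _ 1 (inv_prime_cast_lt_one (p := p)) fun r => ?_)
  obtain ⟨j, hj⟩ := (Fact.out : p.Prime).odd_of_ne_two hodd
  have h := norm_sum_range_odd_mul_sub_le hg (odd_prime_pow hodd r) j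
  rw [← hj, ← pow_succ'] at h
  rw [dist_comm, dist_eq_norm, one_mul]
  simpa [altSum] using h

lemma tendsto_natCast_prime_pow : Tendsto (fun r : ℕ => ((p ^ r : ℕ) : ℚ_[p])) atTop (𝓝 0) := by
  refine squeeze_zero_norm (a := fun r => (p : ℝ)⁻¹ ^ r) (fun r => by simp) ?_
  exact tendsto_pow_atTop_nhds_zero_of_lt_one inv_prime_cast_pos.le inv_prime_cast_lt_one

lemma altSum_add_altSum_shift (hodd : p ≠ 2) (h : ℕ → ℚ_[p]) (r : ℕ) :
    altSum p h r + altSum p (fun k => h (k + 1)) r = h 0 + h (p ^ r) := by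
  have key : ∀ N : ℕ, ∑ k ∈ Finset.range N, (-1 : ℚ_[p]) ^ k * h k +
      ∑ k ∈ Finset.range N, (-1 : ℚ_[p]) ^ k * h (k + 1) = h 0 - (-1) ^ N * h N := by
    intro N
    induction N with
    | zero => simp
    | succ N ih =>
      rw [Finset.sum_range_succ, Finset.sum_range_succ, pow_succ]
      linear_combination ih
  rw [altSum, altSum, key, (odd_prime_pow hodd r).neg_one_pow]
  ring

lemma altSum_tsum {g : ℕ → ℕ → ℚ_[p]} (hg : ∀ k, Summable fun n => g n k) (r : ℕ) :
    altSum p (fun k => ∑' n, g n k) r = ∑' n, altSum p (g n) r := by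
  simp only [altSum, ← tsum_mul_left]
  exact (Summable.tsum_finsetSum fun k _ => (hg k).mul_left _).symm

lemma altSum_const_mul (c : ℚ_[p]) (g : ℕ → ℚ_[p]) (r : ℕ) :
    altSum p (fun k => c * g k) r = c * altSum p g r := by
  simp only [altSum, Finset.mul_sum]
  exact Finset.sum_congr rfl fun k _ => by ring

/-- Fermionic integrals commute with uniformly geometrically convergent series. -/
lemma tendsto_altSum_tsum {g : ℕ → ℕ → ℚ_[p]} {L : ℕ → ℚ_[p]}
    (hg : ∀ n k, ‖g n k‖ ≤ (p : ℝ)⁻¹ ^ n) (hL : ∀ n, Tendsto (altSum p (g n)) atTop (𝓝 (L n))) :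
    Tendsto (altSum p fun k => ∑' n, g n k) atTop (𝓝 (∑' n, L n)) := by
  have h := tendsto_tsum_of_dominated_convergence (f := fun r n => altSum p (g n) r)
    (summable_inv_prime_pow (p := p)) hL (.of_forall fun r n => norm_altSum_le (by positivity)
      (hg n) r)
  refine h.congr fun r => (altSum_tsum (fun k => ?_) r).symm
  exact .of_norm_bounded summable_inv_prime_pow fun n => hg n k

/-! ### Taylor expansion of Newton series -/

lemma inv_prime_pow_mul_inv_norm_factorial_le (hodd : p ≠ 2) (n : ℕ) :
    (p : ℝ)⁻¹ ^ n * ‖(n.factorial : ℚ_[p])‖⁻¹ ≤ √(p : ℝ)⁻¹ ^ n := by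
  have hp3 : 2 ≤ p - 1 := by
    have := (Fact.out : p.Prime).two_le
    omega
  have hv : 2 * padicValNat p n.factorial ≤ n :=
    (Nat.mul_le_mul_right _ hp3).trans
      ((sub_one_mul_padicValNat_factorial (p := p) n).trans_le (Nat.sub_le _ _))
  have hpos : (0 : ℝ) < √(p : ℝ)⁻¹ := Real.sqrt_pos.2 inv_prime_cast_pos
  have hle : √(p : ℝ)⁻¹ ≤ 1 := Real.sqrt_le_one.2 inv_prime_cast_lt_one.le
  have hnorm : ‖(n.factorial : ℚ_[p])‖ = (√(p : ℝ)⁻¹) ^ (2 * padicValNat p n.factorial) := by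
    rw [Padic.norm_eq_zpow_neg_valuation (by exact_mod_cast n.factorial_ne_zero),
      Padic.valuation_natCast, pow_mul, Real.sq_sqrt inv_prime_cast_pos.le, zpow_neg,
      zpow_natCast, inv_pow]
  rw [hnorm, ← div_eq_mul_inv, div_le_iff₀ (by positivity), ← pow_add]
  calc (p : ℝ)⁻¹ ^ n = √(p : ℝ)⁻¹ ^ (2 * n) := by
        rw [pow_mul, Real.sq_sqrt inv_prime_cast_pos.le]
    _ ≤ _ := pow_le_pow_of_le_one hpos.le hle (by omega)

/-- `n! * binom (s - X) n` as a polynomial over `ℤ_p`. -/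
noncomputable def fallingPoly (s : ℤ_[p]) (n : ℕ) : Polynomial ℤ_[p] :=
  ∏ j ∈ Finset.range n, (Polynomial.C (s - j) - Polynomial.X)

lemma natDegree_fallingPoly_le (s : ℤ_[p]) (n : ℕ) : (fallingPoly s n).natDegree ≤ n := by
  refine (Polynomial.natDegree_prod_le _ _).trans
    ((Finset.sum_le_card_nsmul _ _ 1 fun j _ => ?_).trans (by simp))
  exact (Polynomial.natDegree_sub_le _ _).trans
    (max_le (by rw [Polynomial.natDegree_C]; exact zero_le_one) Polynomial.natDegree_X_le)

lemma binom_sub_eq_tsum (s u : ℤ_[p]) (n : ℕ) :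
    binom p (s - u) n =
      ∑' m : ℕ, (((fallingPoly s n).coeff m : ℤ_[p]) : ℚ_[p]) / n.factorial * (u : ℚ_[p]) ^ m := by
  have h : (((fallingPoly s n).eval u : ℤ_[p]) : ℚ_[p]) =
      ∏ j ∈ Finset.range n, ((s - u : ℚ_[p]) - j) := by
    rw [fallingPoly, Polynomial.eval_prod]
    refine (map_prod PadicInt.Coe.ringHom _ _).trans (Finset.prod_congr rfl fun j _ => ?_)
    rw [Polynomial.eval_sub, Polynomial.eval_C, Polynomial.eval_X]
    change ((s - j - u : ℤ_[p]) : ℚ_[p]) = _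
    push_cast
    ring
  have hdeg := Nat.lt_succ_of_le (natDegree_fallingPoly_le s n)
  rw [tsum_eq_sum (s := Finset.range (n + 1)), binom, ← h, Polynomial.eval_eq_sum_range' hdeg,
    PadicInt.coe_sum, Finset.sum_div]
  · refine Finset.sum_congr rfl fun m _ => ?_
    push_cast
    ring
  · intro m hm
    rw [Polynomial.coeff_eq_zero_of_natDegree_lt
      (hdeg.trans_le (by simpa using hm))]
    simp

lemma exists_hasSum_taylor (hodd : p ≠ 2) {e : ℕ → ℚ_[p]} (he : ∀ n, ‖e n‖ ≤ (p : ℝ)⁻¹ ^ n)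
    {s : ℚ_[p]} (hs : ‖s‖ ≤ 1) :
    ∃ d : ℕ → ℚ_[p], ∀ u : ℚ_[p], ‖u‖ ≤ 1 →
      HasSum (fun m => d m * u ^ m) (∑' n, e n * binom p (s - u) n) := by
  obtain ⟨s, rfl⟩ : ∃ z : ℤ_[p], (z : ℚ_[p]) = s := ⟨⟨s, hs⟩, rfl⟩
  set c : ℕ → ℕ → ℚ_[p] := fun n m =>
    e n * ((((fallingPoly s n).coeff m : ℤ_[p]) : ℚ_[p]) / n.factorial) with hc
  refine ⟨fun m => ∑' n, c n m, fun u hu => ?_⟩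
  obtain ⟨u, rfl⟩ : ∃ z : ℤ_[p], (z : ℚ_[p]) = u := ⟨⟨u, hu⟩, rfl⟩
  set t : ℝ := √√(p : ℝ)⁻¹ with ht
  have ht0 : 0 ≤ t := Real.sqrt_nonneg _
  have ht1 : t < 1 := by
    rw [ht, Real.sqrt_lt' one_pos, one_pow, Real.sqrt_lt' one_pos, one_pow]
    exact inv_prime_cast_lt_one
  have htt : t ^ 2 = √(p : ℝ)⁻¹ := Real.sq_sqrt (Real.sqrt_nonneg _)
  have hbound : ∀ n m, ‖c n m * (u : ℚ_[p]) ^ m‖ ≤ t ^ n * t ^ m := by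
    intro n m
    rcases lt_or_ge n m with hnm | hmn
    · have h0 : c n m = 0 := by
        rw [hc]
        dsimp only
        rw [Polynomial.coeff_eq_zero_of_natDegree_lt
          ((natDegree_fallingPoly_le s n).trans_lt hnm)]
        simp
      rw [h0, zero_mul, norm_zero]
      positivity
    · have h1 : ‖(((fallingPoly s n).coeff m : ℤ_[p]) : ℚ_[p])‖ ≤ 1 := PadicInt.norm_le_one _
      calc ‖c n m * (u : ℚ_[p]) ^ m‖ ≤ ‖c n m‖ := by
            rw [norm_mul, norm_pow]
            exact mul_le_of_le_one_right (norm_nonneg _) (pow_le_one₀ (norm_nonneg _) hu)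
        _ ≤ (p : ℝ)⁻¹ ^ n * ‖(n.factorial : ℚ_[p])‖⁻¹ := by
            rw [hc, norm_mul, norm_div, div_eq_mul_inv]
            refine mul_le_mul (he n) ?_ (by positivity) (by positivity)
            exact mul_le_of_le_one_left (by positivity) h1
        _ ≤ √(p : ℝ)⁻¹ ^ n := inv_prime_pow_mul_inv_norm_factorial_le hodd n
        _ = t ^ n * t ^ n := by rw [← htt, ← pow_mul, ← pow_add, two_mul]
        _ ≤ t ^ n * t ^ m :=
            mul_le_mul_of_nonneg_left (pow_le_pow_of_le_one ht0 ht1.le hmn) (by positivity)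
  have hgeo := summable_geometric_of_lt_one ht0 ht1
  have hsum : Summable fun z : ℕ × ℕ => c z.1 z.2 * (u : ℚ_[p]) ^ z.2 := by
    refine .of_norm_bounded (g := fun z : ℕ × ℕ => t ^ z.1 * t ^ z.2)
      (hgeo.mul_of_nonneg hgeo (fun n => ?_) fun n => ?_) fun z => hbound z.1 z.2
    · dsimp; positivity
    · dsimp; positivity
  have hval : ∑' n, e n * binom p ((s : ℚ_[p]) - u) n =
      ∑' m, (∑' n, c n m) * (u : ℚ_[p]) ^ m := by
    simp only [← tsum_mul_right]
    refine Eq.trans (tsum_congr fun n => ?_)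
      (Summable.tsum_comm (f := fun n m => c n m * (u : ℚ_[p]) ^ m) hsum).symm
    rw [binom_sub_eq_tsum, ← tsum_mul_left]
    exact tsum_congr fun m => by rw [hc]; ring
  rw [hval]
  have hs2 := hsum.prod_symm.prod
  simp only [Prod.swap, tsum_mul_right] at hs2
  exact hs2.hasSum

lemma isOpen_Zball : IsOpen (Zball p) := by
  have h : Zball p = Metric.closedBall 0 1 := by
    ext x
    simp [Zball]
  rw [h]
  exact IsUltrametricDist.isOpen_closedBall _ one_ne_zero

lemma iteratedDerivWithin_Zball_eq {f : ℚ_[p] → ℚ_[p]} {d : ℕ → ℚ_[p]} {s : ℚ_[p]} (hs : ‖s‖ ≤ 1)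
    (h : ∀ u : ℚ_[p], ‖u‖ ≤ 1 → HasSum (fun m => d m * u ^ m) (f (s + u))) (k : ℕ) :
    iteratedDerivWithin k f (Zball p) s = k.factorial * d k := by
  have hd : Tendsto d atTop (𝓝 0) := by
    simpa using (h 1 (by simp)).summable.tendsto_atTop_zero
  obtain ⟨C, hC⟩ := (hd.norm.isBoundedUnder_le).bddAbove_range
  have hf : HasFPowerSeriesOnBall f (.ofScalars ℚ_[p] d) s 1 := by
    refine ⟨?_, one_pos, fun {y} hy => ?_⟩
    · refine FormalMultilinearSeries.le_radius_of_bound (r := 1) _ C fun n => ?_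
      rw [FormalMultilinearSeries.ofScalars_norm]
      simpa using hC ⟨n, rfl⟩
    · have hy' : ‖y‖ ≤ 1 := by
        have : ‖y‖ₑ < 1 := by simpa using hy
        rw [← ofReal_norm, ENNReal.ofReal_lt_one] at this
        exact this.le
      simpa [FormalMultilinearSeries.ofScalars_apply_eq, mul_comm] using h y hy'
  have h1 := hf.factorial_smul 1 k
  rw [iteratedDerivWithin_of_isOpen isOpen_Zball hs, iteratedDeriv_eq_iteratedFDeriv, ← h1]
  simp

/-! ### The Euler zeta function -/

lemma norm_inv_le_inv_prime {x : ℚ_[p]} (hx : 1 < ‖x‖) : ‖x⁻¹‖ ≤ (p : ℝ)⁻¹ := by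
  rw [norm_le_inv_iff_lt_one, norm_inv]
  exact inv_lt_one_of_one_lt₀ hx

lemma proj_add_sub_one {a b : ℚ_[p]} (ha : 1 < ‖a‖) (hb : ‖b‖ ≤ 1) :
    proj p (b + a) - 1 = proj p a - 1 + b * (omegaV p a)⁻¹ := by
  rw [proj, proj, omegaV_add ha hb]
  ring

lemma norm_add_natCast_mul_le {x w : ℚ_[p]} (hx : ‖x‖ ≤ (p : ℝ)⁻¹) (hw : ‖w‖ ≤ (p : ℝ)⁻¹) (k : ℕ) :
    ‖x + k * w‖ ≤ (p : ℝ)⁻¹ := by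
  refine (IsUltrametricDist.norm_add_le_max _ _).trans (max_le hx ?_)
  rw [norm_mul]
  exact (mul_le_of_le_one_left (norm_nonneg _)
    (IsUltrametricDist.norm_natCast_le_one _ k)).trans hw

lemma norm_add_natCast_mul_sub_le {x w : ℚ_[p]} (hw : ‖w‖ ≤ (p : ℝ)⁻¹) (k l : ℕ) :
    ‖x + (l + k : ℕ) * w - (x + k * w)‖ ≤ ‖(l : ℚ_[p])‖ := by
  have h : x + (l + k : ℕ) * w - (x + k * w) = l * w := by
    push_cast
    ring
  rw [h, norm_mul]
  exact mul_le_of_le_one_right (norm_nonneg _) (hw.trans inv_prime_cast_lt_one.le)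

lemma exists_moments (hodd : p ≠ 2) {x w : ℚ_[p]} (hx : ‖x‖ ≤ (p : ℝ)⁻¹)
    (hw : ‖w‖ ≤ (p : ℝ)⁻¹) :
    ∃ E : ℕ → ℚ_[p], (∀ n, ‖E n‖ ≤ (p : ℝ)⁻¹ ^ n) ∧ ∀ s : ℚ_[p], ‖s‖ ≤ 1 →
      Tendsto (altSum p fun k => binomSeries p s (x + k * w)) atTop
        (𝓝 (∑' n, E n * binom p s n)) := by
  have hxk := norm_add_natCast_mul_le hx hw
  have hpow : ∀ n k : ℕ, ‖(x + k * w) ^ n‖ ≤ (p : ℝ)⁻¹ ^ n := fun n k => by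
    rw [norm_pow]
    exact pow_le_pow_left₀ (norm_nonneg _) (hxk k) n
  have hex : ∀ n : ℕ, ∃ L, Tendsto (altSum p fun k => (x + k * w) ^ n) atTop (𝓝 L) := fun n =>
    exists_tendsto_altSum hodd fun k l => (norm_pow_sub_pow_le_norm_sub
      ((hxk _).trans inv_prime_cast_lt_one.le) ((hxk _).trans inv_prime_cast_lt_one.le) n).trans
      (norm_add_natCast_mul_sub_le hw k l)
  choose E hE using hex
  refine ⟨E, fun n => le_of_tendsto (hE n).norm
    (.of_forall fun r => norm_altSum_le (by positivity) (hpow n) r), fun s hs => ?_⟩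
  refine tendsto_altSum_tsum (fun n k => norm_binom_mul_pow_le hs (hxk k) n) fun n => ?_
  simp only [mul_comm (E n)]
  exact ((hE n).const_mul _).congr fun r => (altSum_const_mul _ _ r).symm

lemma Pcoef_eq {s : ℚ_[p]} (hs1 : s ≠ 1) (a : ℚ_[p]) (n : ℕ) :
    Pcoef p s a n = 1 / (s - 1) *
      (binom p (1 - s) n * (-(omegaV p a)⁻¹) ^ n + if n = 0 then 1 else 0) := by
  have hs0 : s - 1 ≠ 0 := sub_ne_zero.2 hs1
  rcases n with _ | n
  · simp [Pcoef, binom]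
    ring
  have hP : Pcoef p s a (n + 1) = coeffT p s a (n + 1) := by
    rcases n with _ | n
    · simp [Pcoef, coeffT]
    · rfl
  have h1 : ∏ j ∈ Finset.range (n + 1), (1 - s - (j : ℚ_[p])) =
      (-1) ^ (n + 1) * ((s - 1) * ∏ j ∈ Finset.Icc 1 n, (s - 1 + (j : ℚ_[p]))) := by
    induction n with
    | zero => simp
    | succ n ih =>
      rw [Finset.prod_range_succ, ih (by cases n <;> simp [Pcoef, coeffT]),
        Finset.prod_Icc_succ_top (by omega)]
      push_cast
      ring
  rw [hP, coeffT, binom, h1, Nat.add_sub_cancel, if_neg n.succ_ne_zero, add_zero,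
    neg_pow (omegaV p a)⁻¹, inv_pow, div_eq_mul_inv, mul_inv]
  have h2 : ((-1 : ℚ_[p]) ^ (n + 1)) * (-1) ^ (n + 1) = 1 := by
    rw [← mul_pow]
    simp
  have h3 : (s - 1)⁻¹ * (s - 1) = 1 := inv_mul_cancel₀ hs0
  set P := ∏ j ∈ Finset.Icc 1 n, (s - 1 + (j : ℚ_[p]))
  set F : ℚ_[p] := ((n + 1).factorial : ℚ_[p])⁻¹ with hF
  rw [one_div, div_eq_mul_inv, ← hF]
  linear_combination (-P * F * (omegaV p a ^ (n + 1))⁻¹) * h2 -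
    (P * F * (omegaV p a ^ (n + 1))⁻¹ * ((-1) ^ (n + 1) * (-1) ^ (n + 1))) * h3

end

/-- Main theorem: for an odd prime `p` and `a ∈ ℚ_p` with `|a|_p > 1`, set
`f(t) = ζ_{p,E}(t,a) - ⟨a⟩^{1-t}`.  For every `s ∈ ℤ_p`, `s ≠ 1`, all series converge and
`∑_{n≥0} P_n(s) · exp_p(nD) f(s) = (1/(s-1)) (⟨a-1⟩^{1-s} - ⟨a⟩^{1-s})`, where
`exp_p(nD) f(s) = ∑_{k≥0} (n^k/k!) D^k f(s)` with `D^k` the k-th iterated derivative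
within `ℤ_p`. -/
theorem padic_hurwitz_euler_differential_equation
    (p : ℕ) [Fact p.Prime] (hodd : p ≠ 2)
    (a : ℚ_[p]) (ha : 1 < ‖a‖)
    (f : ℚ_[p] → ℚ_[p]) (hf : ∀ t : ℚ_[p], f t = zetaE p t a - hpow p a (1 - t))
    (s : ℚ_[p]) (hs : ‖s‖ ≤ 1) (hs1 : s ≠ 1) :
    (∀ n : ℕ, Summable fun k : ℕ =>
      ((n : ℚ_[p]) ^ k / (k.factorial : ℚ_[p])) * iteratedDerivWithin k f (Zball p) s) ∧
    Summable (fun n : ℕ =>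
      Pcoef p s a n *
        ∑' k : ℕ,
          ((n : ℚ_[p]) ^ k / (k.factorial : ℚ_[p])) * iteratedDerivWithin k f (Zball p) s) ∧
    ∑' n : ℕ,
        Pcoef p s a n *
          ∑' k : ℕ,
            ((n : ℚ_[p]) ^ k / (k.factorial : ℚ_[p])) * iteratedDerivWithin k f (Zball p) s =
      1 / (s - 1) * (hpow p (a - 1) (1 - s) - hpow p a (1 - s)) := by
  have ha0 : a ≠ 0 := norm_pos_iff.1 (one_pos.trans ha)
  set x := proj p a - 1 with hx_def
  set w := (omegaV p a)⁻¹ with hw_def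
  have hx : ‖x‖ ≤ (p : ℝ)⁻¹ := norm_proj_sub_one_le ha0
  have hw : ‖w‖ ≤ (p : ℝ)⁻¹ := norm_inv_le_inv_prime (by rwa [norm_omegaV ha0])
  have hwneg : ‖-w‖ ≤ (p : ℝ)⁻¹ := by rwa [norm_neg]
  have hxk := norm_add_natCast_mul_le hx hw
  have h1s : ‖1 - s‖ ≤ 1 := by
    rw [sub_eq_add_neg]
    exact (IsUltrametricDist.norm_add_le_max _ _).trans (max_le norm_one.le (by rwa [norm_neg]))
  have hsn : ∀ n : ℕ, ‖1 - s - n‖ ≤ 1 := norm_sub_natCast_le_one h1s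
  obtain ⟨E, hE, hEtend⟩ := exists_moments hodd hx hw
  have hhpow : ∀ (k : ℕ) (t : ℚ_[p]), hpow p ((k : ℚ_[p]) + a) t = binomSeries p t (x + k * w) :=
    fun k t => by
      rw [hpow_eq_binomSeries,
        proj_add_sub_one ha (IsUltrametricDist.norm_natCast_le_one ℚ_[p] k)]
  have hzeta : ∀ t : ℚ_[p], ‖1 - t‖ ≤ 1 →
      zetaE p t a = ∑' n, E n * binom p (1 - t) n := fun t ht => by
    simp only [zetaE, hhpow]
    exact (hEtend (1 - t) ht).limUnder_eq
  have hfsum : ∀ t : ℚ_[p], ‖1 - t‖ ≤ 1 → f t = ∑' n, (E n - x ^ n) * binom p (1 - t) n := by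
    intro t ht
    rw [hf, hzeta t ht, hpow_eq_binomSeries, binomSeries, ← Summable.tsum_sub]
    · exact tsum_congr fun n => by rw [hx_def]; ring
    · refine .of_norm_bounded (summable_inv_prime_pow (p := p)) fun n => ?_
      rw [norm_mul]
      exact (mul_le_of_le_one_right (norm_nonneg _) (norm_binom_le_one ht n)).trans (hE n)
    · exact summable_binom_mul_pow ht hx
  have he : ∀ n, ‖E n - x ^ n‖ ≤ (p : ℝ)⁻¹ ^ n := fun n => by
    rw [sub_eq_add_neg]
    refine (IsUltrametricDist.norm_add_le_max _ _).trans (max_le (hE n) ?_)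
    rw [norm_neg, norm_pow]
    exact pow_le_pow_left₀ (norm_nonneg _) hx n
  obtain ⟨d, hd⟩ := exists_hasSum_taylor hodd he h1s
  have hd' : ∀ u : ℚ_[p], ‖u‖ ≤ 1 → HasSum (fun m => d m * u ^ m) (f (s + u)) := by
    intro u hu
    have h : 1 - (s + u) = 1 - s - u := by ring
    rw [hfsum, h]
    · exact hd u hu
    · rw [h, sub_eq_add_neg]
      exact (IsUltrametricDist.norm_add_le_max _ _).trans (max_le h1s (by rwa [norm_neg]))
  have hexp : ∀ n : ℕ, HasSum (fun k : ℕ => ((n : ℚ_[p]) ^ k / (k.factorial : ℚ_[p])) *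
      iteratedDerivWithin k f (Zball p) s) (f (s + n)) := by
    intro n
    convert! hd' n (IsUltrametricDist.norm_natCast_le_one _ n) using 2 with k
    rw [iteratedDerivWithin_Zball_eq hs hd']
    have : (k.factorial : ℚ_[p]) ≠ 0 := by exact_mod_cast k.factorial_ne_zero
    field_simp
  refine ⟨fun n => (hexp n).summable, ?_⟩
  simp only [fun n => (hexp n).tsum_eq]
  set c : ℕ → ℚ_[p] := fun n => binom p (1 - s) n * (-w) ^ n with hc
  have hcn : ∀ n, ‖c n‖ ≤ (p : ℝ)⁻¹ ^ n := norm_binom_mul_pow_le h1s hwneg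
  set Z : ℕ → ℚ_[p] := fun n => ∑' m, E m * binom p (1 - s - n) m with hZ
  have hcB : ∀ (n : ℕ) {y : ℚ_[p]}, ‖y‖ ≤ (p : ℝ)⁻¹ →
      ‖c n * binomSeries p (1 - s - n) y‖ ≤ (p : ℝ)⁻¹ ^ n := fun n y hy => by
    rw [norm_mul]
    exact (mul_le_of_le_one_right (norm_nonneg _)
      (norm_binomSeries_le_one (hsn n) hy)).trans (hcn n)
  have hfn : ∀ n : ℕ, f (s + n) = Z n - binomSeries p (1 - s - n) x := by
    intro n
    have h : 1 - (s + n) = 1 - s - n := by ring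
    rw [hf, hzeta _ (h ▸ hsn n), hpow_eq_binomSeries, h]
  have hZ1 : ∀ n, ‖Z n‖ ≤ 1 := fun n =>
    IsUltrametricDist.norm_tsum_le_of_forall_le fun m => by
      rw [norm_mul]
      exact mul_le_one₀ ((hE m).trans (pow_le_one₀ inv_prime_cast_pos.le
        inv_prime_cast_lt_one.le)) (norm_nonneg _) (norm_binom_le_one (hsn n) m)
  have hcZsum : Summable fun n => c n * Z n := by
    refine .of_norm_bounded (summable_inv_prime_pow (p := p)) fun n => ?_
    rw [norm_mul]
    exact (mul_le_of_le_one_right (norm_nonneg _) (hZ1 n)).trans (hcn n)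
  have hcBsum : Summable fun n : ℕ => c n * binomSeries p (1 - s - n) x :=
    .of_norm_bounded (summable_inv_prime_pow (p := p)) fun n => hcB n hx
  have hcB_tsum : ∀ {y : ℚ_[p]}, ‖y‖ ≤ (p : ℝ)⁻¹ →
      ∑' n : ℕ, c n * binomSeries p (1 - s - n) y = binomSeries p (1 - s) (y - w) := fun hy => by
    rw [sub_eq_add_neg _ w]
    exact tsum_binom_mul_pow_mul_binomSeries h1s hy hwneg
  set h : ℕ → ℚ_[p] := fun k => binomSeries p (1 - s) (x + k * w - w) with hh
  have hlim1 : Tendsto (altSum p h) atTop (𝓝 (∑' n, c n * Z n)) := by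
    have := tendsto_altSum_tsum (fun n k => hcB n (hxk k)) fun n =>
      ((hEtend _ (hsn n)).const_mul (c n)).congr fun r => (altSum_const_mul _ _ r).symm
    simpa only [hcB_tsum (hxk _)] using this
  have hlim2 : Tendsto (altSum p fun k => h (k + 1)) atTop (𝓝 (Z 0)) := by
    have := hEtend _ (hsn 0)
    convert! this using 4 with k
    simp only [Nat.cast_zero, sub_zero]
    push_cast
    ring
  have hlim3 : Tendsto (fun r => h 0 + h (p ^ r)) atTop (𝓝 (h 0 + h 0)) := by
    refine tendsto_const_nhds.add (tendsto_iff_norm_sub_tendsto_zero.2 ?_)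
    have hxw : ∀ k : ℕ, ‖x + k * w - w‖ ≤ (p : ℝ)⁻¹ := fun k => by
      rw [sub_eq_add_neg]
      exact (IsUltrametricDist.norm_add_le_max _ _).trans (max_le (hxk k) hwneg)
    refine squeeze_zero (fun r => norm_nonneg _) (fun r => ?_)
      (tendsto_zero_iff_norm_tendsto_zero.1 (tendsto_natCast_prime_pow (p := p)))
    refine (norm_binomSeries_sub_le h1s (hxw _) (hxw _)).trans ?_
    rw [sub_sub_sub_cancel_right]
    exact norm_add_natCast_mul_sub_le hw 0 (p ^ r)
  have hkey : ∑' n, c n * Z n + Z 0 = h 0 + h 0 :=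
    tendsto_nhds_unique (hlim1.add hlim2)
      (hlim3.congr fun r => (altSum_add_altSum_shift hodd h r).symm)
  have hh0 : h 0 = hpow p (a - 1) (1 - s) := by
    have h1 : a - 1 = -1 + a := by ring
    rw [hpow_eq_binomSeries, h1, proj_add_sub_one ha (by simp)]
    simp only [hh]
    congr 1
    push_cast
    ring
  have hsum : HasSum (fun n => c n * f (s + n)) (h 0 - Z 0) := by
    have h1 := hcZsum.hasSum.sub hcBsum.hasSum
    rw [hcB_tsum hx] at h1
    convert! h1 using 1
    · ext n
      rw [hfn]
      ring
    · have : h 0 = binomSeries p (1 - s) (x - w) := by simp [hh]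
      rw [← this]
      linear_combination -hkey
  have hfinal : HasSum (fun n => Pcoef p s a n * f (s + n))
      (1 / (s - 1) * (hpow p (a - 1) (1 - s) - hpow p a (1 - s))) := by
    have h1 := (hsum.add (hasSum_ite_eq 0 (f s))).mul_left (1 / (s - 1))
    convert! h1 using 1
    · ext n
      rw [Pcoef_eq hs1]
      rcases n with _ | n
      · simp [hc]
        ring
      · simp [hc]
        ring
    · have h0 := hfn 0
      simp only [Nat.cast_zero, add_zero, sub_zero] at h0
      rw [hpow_eq_binomSeries a, ← hh0, h0]
      ring
  exact ⟨hfinal.summable, hfinal.tsum_eq⟩
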